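/- arXiv:2304.05460 — 7 statements merged into one kernel-verified Lean document; each statement's English description precedes it below -/
import Mathlib

section
/- Let X be a finite set with at least k ≥ 2 points in a metric space, and let X_k = {x_1, …, x_k} be the first k points produced by farthest point sampling on X. Then the fill distance of X_k in X is at most its separation distance: h_{X_k} ≤ q_{X_k}. -/
/-- Two distinct points selected by farthest point sampling are at least as far apart as any point
of `X` is from the selected set. -/
theorem infDist_range_le_dist_of_farthest
    {α ι : Type*} [PseudoMetricSpace α] [LinearOrder ι] {X : Set α} {x : ι → α}
    (hfar : ∀ i : ι, ∀ y ∈ X, y ∉ x '' {j : ι | j < i} →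
      Metric.infDist y (x '' {j : ι | j < i}) ≤
        Metric.infDist (x i) (x '' {j : ι | j < i}))
    {y : α} (hy : y ∈ X) {i j : ι} (hij : i ≠ j) :
    Metric.infDist y (Set.range x) ≤ dist (x i) (x j) := by
  wlog hlt : j < i generalizing i j
  · rw [dist_comm]
    exact this hij.symm (hij.lt_of_le (not_lt.mp hlt))
  have hj : x j ∈ x '' {j : ι | j < i} := Set.mem_image_of_mem x hlt
  by_cases hyx : y ∈ x '' {j : ι | j < i}
  · rw [Metric.infDist_zero_of_mem (Set.image_subset_range _ _ hyx)]
    exact dist_nonneg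
  · calc Metric.infDist y (Set.range x)
        ≤ Metric.infDist y (x '' {j : ι | j < i}) :=
          Metric.infDist_le_infDist_of_subset (Set.image_subset_range _ _) ⟨_, hj⟩
      _ ≤ Metric.infDist (x i) (x '' {j : ι | j < i}) := hfar i y hy hyx
      _ ≤ dist (x i) (x j) := Metric.infDist_le_dist_of_mem hj

/-- first part of Theorem 3.3.
Let `X` be a finite set with at least `k ≥ 2` points in a metric space, and let
`x 0, …, x (k-1)` be the first `k` points produced by farthest point sampling on `X`
(i.e. each new point lies in `X`, is not among the previously selected points, and
maximizes the distance to the set of previously selected points over `X`).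
Then the fill distance of `X_k` in `X` is at most its separation distance:
`h_{X_k} ≤ q_{X_k}`. -/
theorem fps_fill_le_separation
    {α : Type*} [MetricSpace α] (X : Finset α) (k : ℕ) (hk : 2 ≤ k)
    (hXcard : k ≤ X.card)
    (x : Fin k → α)
    (hmem : ∀ i, x i ∈ X)
    (hnew : ∀ i : Fin k, x i ∉ x '' {j : Fin k | j < i})
    (hfar : ∀ i : Fin k, ∀ y ∈ X, y ∉ x '' {j : Fin k | j < i} →
      Metric.infDist y (x '' {j : Fin k | j < i}) ≤
        Metric.infDist (x i) (x '' {j : Fin k | j < i}))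
    (h q : ℝ)
    (hh : h = ⨆ y : X, Metric.infDist (y : α) (Set.range x))
    (hq : q = ⨅ p : {p : Fin k × Fin k // p.1 ≠ p.2}, dist (x p.1.1) (x p.1.2)) :
    h ≤ q := by
  have : Nonempty X := ⟨⟨x ⟨0, by lia⟩, hmem _⟩⟩
  have : Nonempty {p : Fin k × Fin k // p.1 ≠ p.2} :=
    ⟨⟨(⟨0, by lia⟩, ⟨1, by lia⟩), by simp⟩⟩
  rw [hh, hq]
  exact ciSup_le fun y => le_ciInf fun p =>
    infDist_range_le_dist_of_farthest (X := (X : Set α)) hfar y.2 p.2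
end

section
/- Let X be a finite set with at least k ≥ 2 points in a metric space, and let X_k = {x_1, …, x_k} be the first k points produced by farthest point sampling on X. Then for every subset Y ⊆ X with exactly k points, q_{X_k} ≥ (1/2) · q_Y; that is, the separation distance of the FPS points is at least half the maximal separation distance achievable by any k-point subset of X. -/
/-- A finite set that is covered, within distance `d`, by fewer centres than it has points
contains two distinct points at distance at most `2 * d`. -/
theorem exists_ne_dist_le_two_mul_of_card_lt {α ι : Type*} [PseudoMetricSpace α]
    {Y : Finset α} {C : Finset ι} {x : ι → α} {d : ℝ} (hcard : C.card < Y.card)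
    (hcover : ∀ y ∈ Y, ∃ c ∈ C, dist y (x c) ≤ d) :
    ∃ y ∈ Y, ∃ z ∈ Y, y ≠ z ∧ dist y z ≤ 2 * d := by
  obtain ⟨y₀, hy₀⟩ := Finset.card_pos.mp (Nat.zero_lt_of_lt hcard)
  have : Nonempty ι := ⟨(hcover y₀ hy₀).choose⟩
  choose! c hcC hcd using hcover
  obtain ⟨y, hy, z, hz, hyz, hc⟩ := Finset.exists_ne_map_eq_of_card_lt_of_maps_to hcard hcC
  refine ⟨y, hy, z, hz, hyz, ?_⟩
  have hdy := hcd y hy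
  have hdz := hcd z hz
  rw [← hc] at hdz
  linarith [dist_triangle_right y z (x (c y))]

/-- If `x i` is at least as far from the earlier points as every remaining point of `X`, then
every point of `X` is within `dist (x i) (x j)` of some earlier point, for each `j < i`. -/
theorem exists_lt_dist_le_of_farthest {α : Type*} [PseudoMetricSpace α] {X : Finset α} {k : ℕ}
    {x : Fin k → α} {i j : Fin k}
    (hfar : ∀ y ∈ X, y ∉ x '' {j : Fin k | j < i} →
      Metric.infDist y (x '' {j : Fin k | j < i}) ≤
        Metric.infDist (x i) (x '' {j : Fin k | j < i}))
    (hji : j < i) {y : α} (hy : y ∈ X) :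
    ∃ c < i, dist y (x c) ≤ dist (x i) (x j) := by
  have hj : x j ∈ x '' {j : Fin k | j < i} := ⟨j, hji, rfl⟩
  by_cases hyx : y ∈ x '' {j : Fin k | j < i}
  · obtain ⟨c, hc, rfl⟩ := hyx
    exact ⟨c, hc, by simp⟩
  · obtain ⟨_, ⟨c, hc, rfl⟩, hdist⟩ :=
      ((Set.toFinite {j : Fin k | j < i}).image x).isCompact.exists_infDist_eq_dist ⟨_, hj⟩ y
    exact ⟨c, hc, hdist ▸ (hfar y hy hyx).trans (Metric.infDist_le_dist_of_mem hj)⟩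

/-- second part of Theorem 3.3.
Let `X` be a finite set with at least `k ≥ 2` points in a metric space, and let
`x 0, …, x (k-1)` be the first `k` points produced by farthest point sampling on `X`.
Then for every subset `Y ⊆ X` with exactly `k` points, the separation distance `q` of the
FPS points is at least half the separation distance `qY` of `Y`:  `q ≥ (1/2) · qY`. -/
theorem fps_separation_near_optimal
    {α : Type*} [MetricSpace α] (X : Finset α) (k : ℕ) (hk : 2 ≤ k)
    (hXcard : k ≤ X.card)
    (x : Fin k → α)
    (hmem : ∀ i, x i ∈ X)
    (hnew : ∀ i : Fin k, x i ∉ x '' {j : Fin k | j < i})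
    (hfar : ∀ i : Fin k, ∀ y ∈ X, y ∉ x '' {j : Fin k | j < i} →
      Metric.infDist y (x '' {j : Fin k | j < i}) ≤
        Metric.infDist (x i) (x '' {j : Fin k | j < i}))
    (q : ℝ)
    (hq : q = ⨅ p : {p : Fin k × Fin k // p.1 ≠ p.2}, dist (x p.1.1) (x p.1.2))
    (Y : Finset α) (hYX : Y ⊆ X) (hYcard : Y.card = k)
    (qY : ℝ)
    (hqY : qY = ⨅ p : {p : {a // a ∈ Y} × {a // a ∈ Y} // p.1 ≠ p.2},
      dist (p.1.1 : α) (p.1.2 : α)) :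
    (1 / 2) * qY ≤ q := by
  have hpair : ∀ i j : Fin k, j < i → qY ≤ 2 * dist (x i) (x j) := by
    intro i j hji
    have hcard : (Finset.Iio i).card < Y.card := by
      rw [Fin.card_Iio, hYcard]
      exact i.isLt
    obtain ⟨y, hy, z, hz, hyz, hd⟩ := exists_ne_dist_le_two_mul_of_card_lt
      (x := x) (d := dist (x i) (x j)) hcard fun y hy => by
        simpa using exists_lt_dist_le_of_farthest (hfar i) hji (hYX hy)
    refine le_trans ?_ hd
    rw [hqY]
    exact ciInf_le (Set.finite_range _).bddBelow
      (⟨(⟨y, hy⟩, ⟨z, hz⟩), by simpa using hyz⟩ :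
        {p : {a // a ∈ Y} × {a // a ∈ Y} // p.1 ≠ p.2})
  have : Nonempty {p : Fin k × Fin k // p.1 ≠ p.2} :=
    ⟨⟨(⟨0, by lia⟩, ⟨1, by lia⟩), by simp⟩⟩
  rw [hq]
  refine le_ciInf fun ⟨⟨i, j⟩, hij⟩ => ?_
  rcases lt_or_gt_of_ne hij with h | h
  · have := hpair j i h
    rw [dist_comm] at this
    linarith
  · linarith [hpair i j h]
end

section
/- Let X be a finite set with at least k + 1 points (k ≥ 1) in a metric space, and let X_k = {x_1, …, x_k} be the first k points produced by farthest point sampling on X. Then for every subset Y ⊆ X with exactly k points, h_{X_k} ≤ 2 · h_Y; that is, the fill distance of the FPS points is at most twice the minimal fill distance achievable by any k-point subset of X. -/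
/-- If at least `#Y + 1` points are at pairwise distance at least `r`, and each of them is within
`c` of the finite set `Y`, then `r ≤ 2 * c`. -/
theorem le_two_mul_of_separated_of_infDist_le {α ι : Type*} [MetricSpace α] [Fintype ι]
    {Y : Finset α} (hYne : Y.Nonempty) (hcard : Y.card < Fintype.card ι) {z : ι → α} {r c : ℝ}
    (hsep : ∀ i j, i ≠ j → r ≤ dist (z i) (z j))
    (hcov : ∀ i, Metric.infDist (z i) (Y : Set α) ≤ c) : r ≤ 2 * c := by
  have hnear : ∀ i, ∃ p ∈ Y, dist (z i) p ≤ c := fun i => by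
    obtain ⟨p, hp, he⟩ := Y.finite_toSet.isCompact.exists_infDist_eq_dist hYne (z i)
    exact ⟨p, hp, he ▸ hcov i⟩
  choose p hpY hp using hnear
  obtain ⟨i, j, hij, he⟩ := Fintype.exists_ne_map_eq_of_card_lt
    (fun i => (⟨p i, hpY i⟩ : Y)) (by simpa using hcard)
  have he : p i = p j := congrArg Subtype.val he
  have hj := hp j
  rw [← he] at hj
  linarith [hsep i j hij, hp i, dist_triangle_right (z i) (z j) (p i)]


/-- third part of Theorem 3.3.
Let `X` be a finite set with at least `k + 1` points (`k ≥ 1`) in a metric space, and let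
`x 0, …, x (k-1)` be the first `k` points produced by farthest point sampling on `X`.
Then for every subset `Y ⊆ X` with exactly `k` points, the fill distance `h` of the FPS
points in `X` is at most twice the fill distance `hY` of `Y` in `X`:  `h ≤ 2 · hY`. -/
theorem fps_fill_near_optimal
    {α : Type*} [MetricSpace α] (X : Finset α) (k : ℕ) (hk : 1 ≤ k)
    (hXcard : k + 1 ≤ X.card)
    (x : Fin k → α)
    (hmem : ∀ i, x i ∈ X)
    (hnew : ∀ i : Fin k, x i ∉ x '' {j : Fin k | j < i})
    (hfar : ∀ i : Fin k, ∀ y ∈ X, y ∉ x '' {j : Fin k | j < i} →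
      Metric.infDist y (x '' {j : Fin k | j < i}) ≤
        Metric.infDist (x i) (x '' {j : Fin k | j < i}))
    (h : ℝ)
    (hh : h = ⨆ y : X, Metric.infDist (y : α) (Set.range x))
    (Y : Finset α) (hYX : Y ⊆ X) (hYcard : Y.card = k)
    (hY : ℝ)
    (hhY : hY = ⨆ y : X, Metric.infDist (y : α) (Y : Set α)) :
    h ≤ 2 * hY := by
  have hYne : Y.Nonempty := Finset.card_pos.mp (by omega)
  have hle : ∀ y ∈ X, Metric.infDist y (Y : Set α) ≤ hY := fun y hy =>
    hhY ▸ le_ciSup (f := fun y : X => Metric.infDist (y : α) (Y : Set α))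
      (Set.finite_range _).bddAbove ⟨y, hy⟩
  have : Nonempty X := (Finset.card_pos.mp (by omega : 0 < X.card)).to_subtype
  rw [hh]
  refine ciSup_le fun ⟨y, hy⟩ => ?_
  by_cases hyr : y ∈ Set.range x
  · rw [Metric.infDist_zero_of_mem hyr]
    linarith [hle y hy, Metric.infDist_nonneg (x := y) (s := (Y : Set α))]
  have hlt : ∀ i j, j < i → Metric.infDist y (Set.range x) ≤ dist (x i) (x j) := by
    intro i j hji
    have hj : x j ∈ x '' {j : Fin k | j < i} := ⟨j, hji, rfl⟩
    calc Metric.infDist y (Set.range x)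
        ≤ Metric.infDist y (x '' {j : Fin k | j < i}) :=
          Metric.infDist_le_infDist_of_subset (Set.image_subset_range _ _) ⟨_, hj⟩
      _ ≤ Metric.infDist (x i) (x '' {j : Fin k | j < i}) :=
          hfar i y hy fun hm => hyr (Set.image_subset_range _ _ hm)
      _ ≤ dist (x i) (x j) := Metric.infDist_le_dist_of_mem hj
  refine le_two_mul_of_separated_of_infDist_le (ι := Option (Fin k))
    (z := fun o => o.elim y x) hYne (by simp [hYcard]) ?_ ?_
  · rintro (_ | i) (_ | j) hij
    · exact absurd rfl hij
    · exact Metric.infDist_le_dist_of_mem ⟨j, rfl⟩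
    · exact (dist_comm y (x i)) ▸ Metric.infDist_le_dist_of_mem (Set.mem_range_self i)
    · rcases lt_or_gt_of_ne (fun h => hij (congrArg some h) : i ≠ j) with hlt' | hlt'
      · exact (hlt j i hlt').trans_eq (dist_comm _ _)
      · exact hlt i j hlt'
  · rintro (_ | i)
    · exact hle y hy
    · exact hle _ (hmem i)
end

section
/- Let X be a finite set with at least k + 1 points (k ≥ 1) in a metric space, let X_k = {x_1, …, x_k} and X_{k+1} = {x_1, …, x_{k+1}} be the first k and k + 1 points produced by farthest point sampling on X. Then q_{X_{k+1}} ≥ h_{X_k}: the separation distance after selecting one more FPS point is at least the fill distance of the current FPS set. -/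
/-- intermediate claim in the proof of Theorem 3.3.
Let `X` be a finite set with at least `k + 1` points (`k ≥ 1`) in a metric space, and let
`x 0, …, x k` be the first `k + 1` points produced by farthest point sampling on `X`.
Then the separation distance of the first `k + 1` points is at least the fill distance of
the first `k` points:  `q_{X_{k+1}} ≥ h_{X_k}`. -/
theorem fps_separation_succ_ge_fill
    {α : Type*} [MetricSpace α] (X : Finset α) (k : ℕ) (hk : 1 ≤ k)
    (hXcard : k + 1 ≤ X.card)
    (x : Fin (k + 1) → α)
    (hmem : ∀ i, x i ∈ X)
    (hnew : ∀ i : Fin (k + 1), x i ∉ x '' {j : Fin (k + 1) | j < i})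
    (hfar : ∀ i : Fin (k + 1), ∀ y ∈ X, y ∉ x '' {j : Fin (k + 1) | j < i} →
      Metric.infDist y (x '' {j : Fin (k + 1) | j < i}) ≤
        Metric.infDist (x i) (x '' {j : Fin (k + 1) | j < i}))
    (h q : ℝ)
    (hh : h = ⨆ y : X, Metric.infDist (y : α) (x '' {j : Fin (k + 1) | (j : ℕ) < k}))
    (hq : q = ⨅ p : {p : Fin (k + 1) × Fin (k + 1) // p.1 ≠ p.2},
      dist (x p.1.1) (x p.1.2)) :
    h ≤ q := by
  have key : ∀ y ∈ X, ∀ i j : Fin (k + 1), i < j →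
      Metric.infDist y (x '' {l : Fin (k + 1) | (l : ℕ) < k}) ≤ dist (x i) (x j) := by
    intro y hy i j hij
    have hi : x i ∈ x '' {l : Fin (k + 1) | l < j} := ⟨i, hij, rfl⟩
    have hsub : x '' {l : Fin (k + 1) | l < j} ⊆ x '' {l : Fin (k + 1) | (l : ℕ) < k} :=
      Set.image_mono fun l (hl : l < j) => show (l : ℕ) < k by omega
    calc Metric.infDist y (x '' {l : Fin (k + 1) | (l : ℕ) < k})
        ≤ Metric.infDist y (x '' {l : Fin (k + 1) | l < j}) :=
          Metric.infDist_le_infDist_of_subset hsub ⟨_, hi⟩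
      _ ≤ Metric.infDist (x j) (x '' {l : Fin (k + 1) | l < j}) := by
          by_cases hyj : y ∈ x '' {l : Fin (k + 1) | l < j}
          · rw [Metric.infDist_zero_of_mem hyj]
            exact Metric.infDist_nonneg
          · exact hfar j y hy hyj
      _ ≤ dist (x j) (x i) := Metric.infDist_le_dist_of_mem hi
      _ = dist (x i) (x j) := dist_comm _ _
  have : Nonempty X := ⟨⟨x 0, hmem 0⟩⟩
  have : Nonempty {p : Fin (k + 1) × Fin (k + 1) // p.1 ≠ p.2} :=
    ⟨⟨(0, Fin.last k), fun h0 => by simp [Fin.ext_iff] at h0; omega⟩⟩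
  rw [hh, hq]
  refine ciSup_le fun y => le_ciInf fun p => ?_
  rcases lt_or_gt_of_ne p.2 with hlt | hgt
  · exact key y y.2 _ _ hlt
  · rw [dist_comm]
    exact key y y.2 _ _ hgt
end

section
/- Let X be a finite set with at least k + 1 points (k ≥ 1) in a metric space, and let x_1, …, x_{k+1} be the first k + 1 points produced by farthest point sampling on X. Then dist(x_i, x_j) ≥ h_{X_k} for all distinct i, j ∈ {1, …, k+1}, where X_k = {x_1, …, x_k}. -/
/-- intermediate claim in the proof of Theorem 3.3.
Let `X` be a finite set with at least `k + 1` points (`k ≥ 1`) in a metric space, and let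
`x 0, …, x k` be the first `k + 1` points produced by farthest point sampling on `X`.
Then `dist (x i) (x j) ≥ h_{X_k}` for all distinct `i, j`, where `h_{X_k}` is the fill
distance in `X` of the first `k` FPS points. -/
theorem fps_pairwise_dist_ge_fill
    {α : Type*} [MetricSpace α] (X : Finset α) (k : ℕ) (hk : 1 ≤ k)
    (hXcard : k + 1 ≤ X.card)
    (x : Fin (k + 1) → α)
    (hmem : ∀ i, x i ∈ X)
    (hnew : ∀ i : Fin (k + 1), x i ∉ x '' {j : Fin (k + 1) | j < i})
    (hfar : ∀ i : Fin (k + 1), ∀ y ∈ X, y ∉ x '' {j : Fin (k + 1) | j < i} →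
      Metric.infDist y (x '' {j : Fin (k + 1) | j < i}) ≤
        Metric.infDist (x i) (x '' {j : Fin (k + 1) | j < i}))
    (h : ℝ)
    (hh : h = ⨆ y : X, Metric.infDist (y : α) (x '' {j : Fin (k + 1) | (j : ℕ) < k})) :
    ∀ i j : Fin (k + 1), i ≠ j → h ≤ dist (x i) (x j) := by
  have key : ∀ i j : Fin (k + 1), i < j → h ≤ dist (x i) (x j) := by
    intro i j hij
    have hi : x i ∈ x '' {l : Fin (k + 1) | l < j} := ⟨i, hij, rfl⟩
    have hsub : x '' {l : Fin (k + 1) | l < j} ⊆ x '' {l : Fin (k + 1) | (l : ℕ) < k} :=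
      Set.image_mono fun l hl => lt_of_lt_of_le hl (Nat.lt_succ_iff.mp j.isLt)
    have : Nonempty X := ⟨⟨x i, hmem i⟩⟩
    rw [hh]
    refine ciSup_le fun y => (Metric.infDist_le_infDist_of_subset hsub ⟨_, hi⟩).trans ?_
    by_cases hy : (y : α) ∈ x '' {l : Fin (k + 1) | l < j}
    · rw [Metric.infDist_zero_of_mem hy]
      exact dist_nonneg
    · rw [dist_comm]
      exact (hfar j y y.2 hy).trans (Metric.infDist_le_dist_of_mem hi)
  intro i j hij
  rcases lt_or_gt_of_ne hij with hlt | hgt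
  · exact key i j hlt
  · rw [dist_comm]
    exact key j i hgt
end

section
/- Let X be a finite set in a metric space, let x_1, …, x_k (k ≥ 2) be the first k points produced by farthest point sampling on X, and suppose the separation distance of X_k = {x_1, …, x_k} is attained by the pair (x_j, x_m) with j < m, i.e., q_{X_k} = dist(x_j, x_m). Then dist(x_j, x_m) = h_{X_{m-1}}, where h_{X_{m-1}} = max_{x ∈ X} dist(x, X_{m-1}) is the fill distance in X of the first m − 1 FPS points. -/
/-- equation (3.7) in the proof of Theorem 3.3.
Let `X` be a finite set in a metric space, let `x 0, …, x (k-1)` (`k ≥ 2`) be the first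
`k` points produced by farthest point sampling on `X`, and suppose the separation distance
of `X_k` is attained by the pair `(x j, x m)` with `j < m`.  Then
`dist (x j) (x m) = h_{X_{m-1}}`, the fill distance in `X` of the points selected
before `x m`. -/
theorem fps_separation_eq_fill_at_selection
    {α : Type*} [MetricSpace α] (X : Finset α) (k : ℕ) (hk : 2 ≤ k)
    (hXcard : k ≤ X.card)
    (x : Fin k → α)
    (hmem : ∀ i, x i ∈ X)
    (hnew : ∀ i : Fin k, x i ∉ x '' {i' : Fin k | i' < i})
    (hfar : ∀ i : Fin k, ∀ y ∈ X, y ∉ x '' {i' : Fin k | i' < i} →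
      Metric.infDist y (x '' {i' : Fin k | i' < i}) ≤
        Metric.infDist (x i) (x '' {i' : Fin k | i' < i}))
    (j m : Fin k) (hjm : j < m)
    (hq : (⨅ p : {p : Fin k × Fin k // p.1 ≠ p.2}, dist (x p.1.1) (x p.1.2)) =
      dist (x j) (x m)) :
    dist (x j) (x m) =
      ⨆ y : X, Metric.infDist (y : α) (x '' {i' : Fin k | i' < m}) := by
  set S : Set α := x '' {i' : Fin k | i' < m}
  have hjS : x j ∈ S := ⟨j, hjm, rfl⟩
  have hfill : ∀ y : X, Metric.infDist (y : α) S ≤ Metric.infDist (x m) S := by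
    intro y
    by_cases hy : (y : α) ∈ S
    · rw [Metric.infDist_zero_of_mem hy]
      exact Metric.infDist_nonneg
    · exact hfar m y y.2 hy
  have hxm : Metric.infDist (x m) S = dist (x j) (x m) := by
    apply le_antisymm
    · rw [dist_comm]
      exact Metric.infDist_le_dist_of_mem hjS
    · rw [Metric.le_infDist ⟨x j, hjS⟩]
      rintro _ ⟨i, hi, rfl⟩
      rw [← hq]
      exact ciInf_le (Set.finite_range _).bddBelow
        (⟨(m, i), (ne_of_lt hi).symm⟩ : {p : Fin k × Fin k // p.1 ≠ p.2})
  rw [← hxm]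
  have : Nonempty X := ⟨⟨x m, hmem m⟩⟩
  exact le_antisymm
    (le_ciSup (f := fun y : X => Metric.infDist (y : α) S) (Set.finite_range _).bddAbove
      ⟨x m, hmem m⟩)
    (ciSup_le hfill)
end

section
/- Let μ > 0, let K_11 be a real symmetric k × k matrix, let L be an invertible k × k matrix with L Lᵀ = K_11 + μI, let K_12 be a real k × (n − k) matrix, let G be an invertible (n − k) × (n − k) matrix, and let M = [[L, 0], [K_12ᵀ L^{-ᵀ}, G^{-1}]] · [[Lᵀ, L^{-1} K_12], [0, G^{-ᵀ}]]. Given any vectors r_1 ∈ ℝ^k and r_2 ∈ ℝ^{n−k}, define s_2 = Gᵀ G (r_2 − K_12ᵀ (L Lᵀ)^{-1} r_1) and s_1 = (L Lᵀ)^{-1} (r_1 − K_12 s_2). Then M (s_1; s_2) = (r_1; r_2), i.e., the two-step back-substitution algorithm solves the preconditioner system exactly. -/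
open Matrix

/-- The product of the block triangular factors has diagonal block `L * Lᵀ` with
Schur complement `(Gᵀ * G)⁻¹`. -/
theorem fromBlocks_mul_fromBlocks_eq_schur {m n R : Type*} [Fintype m] [DecidableEq m]
    [Fintype n] [DecidableEq n] [CommRing R] (L : Matrix m m R) (hL : IsUnit L)
    (K : Matrix m n R) (G : Matrix n n R) :
    fromBlocks L 0 (Kᵀ * (L⁻¹)ᵀ) G⁻¹ * fromBlocks Lᵀ (L⁻¹ * K) 0 (G⁻¹)ᵀ =
      fromBlocks (L * Lᵀ) K Kᵀ (Kᵀ * (L * Lᵀ)⁻¹ * K + (Gᵀ * G)⁻¹) := by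
  have hdet : IsUnit L.det := (isUnit_iff_isUnit_det L).mp hL
  have hT : (L⁻¹)ᵀ * Lᵀ = 1 := by
    rw [← transpose_mul, mul_nonsing_inv L hdet, transpose_one]
  rw [fromBlocks_multiply, mul_nonsing_inv_cancel_left _ _ hdet, Matrix.mul_assoc Kᵀ _ Lᵀ, hT]
  simp [Matrix.mul_inv_rev, transpose_nonsing_inv, Matrix.mul_assoc]

/-- Block back-substitution solves a system with invertible diagonal block `A` and
invertible Schur complement `S⁻¹`. -/
theorem fromBlocks_mulVec_back_substitution {m n R : Type*} [Fintype m] [DecidableEq m]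
    [Fintype n] [DecidableEq n] [CommRing R] (A : Matrix m m R) (hA : IsUnit A)
    (B : Matrix m n R) (C : Matrix n m R) (S : Matrix n n R) (hS : IsUnit S)
    (r₁ s₁ : m → R) (r₂ s₂ : n → R)
    (hs₂ : s₂ = S *ᵥ (r₂ - C *ᵥ (A⁻¹ *ᵥ r₁))) (hs₁ : s₁ = A⁻¹ *ᵥ (r₁ - B *ᵥ s₂)) :
    fromBlocks A B C (C * A⁻¹ * B + S⁻¹) *ᵥ Sum.elim s₁ s₂ = Sum.elim r₁ r₂ := by
  have hAs : A *ᵥ s₁ = r₁ - B *ᵥ s₂ := by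
    rw [hs₁, mulVec_mulVec, mul_nonsing_inv A ((isUnit_iff_isUnit_det A).mp hA), one_mulVec]
  have hSs : S⁻¹ *ᵥ s₂ = r₂ - C *ᵥ (A⁻¹ *ᵥ r₁) := by
    rw [hs₂, mulVec_mulVec, nonsing_inv_mul S ((isUnit_iff_isUnit_det S).mp hS), one_mulVec]
  rw [fromBlocks_mulVec]
  simp only [Sum.elim_comp_inl, Sum.elim_comp_inr]
  congr 1
  · rw [hAs, sub_add_cancel]
  · rw [add_mulVec, hSs, hs₁]
    simp only [mulVec_sub, ← mulVec_mulVec]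
    abel

/-- correctness of the AFN preconditioning operation, Section 2.
Let `μ > 0`, `K₁₁` real symmetric `k × k`, `L` invertible with `L Lᵀ = K₁₁ + μI`,
`K₁₂` real `k × (n − k)`, `G` invertible `(n − k) × (n − k)`, and let `M` be the AFN
preconditioner.  Given `r₁ ∈ ℝ^k`, `r₂ ∈ ℝ^(n−k)`, set
`s₂ = Gᵀ G (r₂ − K₁₂ᵀ (L Lᵀ)⁻¹ r₁)` and `s₁ = (L Lᵀ)⁻¹ (r₁ − K₁₂ s₂)`.
Then `M (s₁; s₂) = (r₁; r₂)`. -/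
theorem afn_back_substitution_solves
    (n k : ℕ) (μ : ℝ) (hμ : 0 < μ)
    (K11 : Matrix (Fin k) (Fin k) ℝ) (hK11 : K11.IsSymm)
    (L : Matrix (Fin k) (Fin k) ℝ) (hL : IsUnit L)
    (hLL : L * Lᵀ = K11 + μ • (1 : Matrix (Fin k) (Fin k) ℝ))
    (K12 : Matrix (Fin k) (Fin (n - k)) ℝ)
    (G : Matrix (Fin (n - k)) (Fin (n - k)) ℝ) (hG : IsUnit G)
    (r1 : Fin k → ℝ) (r2 : Fin (n - k) → ℝ)
    (s1 : Fin k → ℝ) (s2 : Fin (n - k) → ℝ)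
    (hs2 : s2 = (Gᵀ * G).mulVec (r2 - K12ᵀ.mulVec ((L * Lᵀ)⁻¹.mulVec r1)))
    (hs1 : s1 = (L * Lᵀ)⁻¹.mulVec (r1 - K12.mulVec s2)) :
    (Matrix.fromBlocks L 0 (K12ᵀ * (L⁻¹)ᵀ) G⁻¹ *
        Matrix.fromBlocks Lᵀ (L⁻¹ * K12) 0 (G⁻¹)ᵀ).mulVec (Sum.elim s1 s2) =
      Sum.elim r1 r2 := by
  rw [fromBlocks_mul_fromBlocks_eq_schur L hL K12 G]
  exact fromBlocks_mulVec_back_substitution _ (hL.mul ((isUnit_transpose L).mpr hL)) _ _ _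
    (((isUnit_transpose G).mpr hG).mul hG) _ _ _ _ hs2 hs1
end
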